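/- Let c be an integer with |c| ≥ 2, and let (x_n) satisfy x_0 = 4c² − 1, x_1 = 2c³, and x_{n+1} = 2c·x_n − c²·x_{n-1}. Then x_2 = c² and x_n = c^n·((n−1) − (2n−4)c²) for all n ≥ 3; moreover x_n ≠ 0 for all n. -/

import Mathlib

theorem eq_pow_mul_of_recurrence {R : Type*} [CommRing R] (c : R) (x : ℕ → R)
    (hx0 : x 0 = 4 * c ^ 2 - 1) (hx1 : x 1 = 2 * c ^ 3)
    (hrec : ∀ n : ℕ, x (n + 2) = 2 * c * x (n + 1) + (-(c ^ 2)) * x n) (n : ℕ) :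
    x n = c ^ n * (((n : R) - 1) - (2 * (n : R) - 4) * c ^ 2) := by
  induction n using Nat.twoStepInduction with
  | zero => rw [hx0]; push_cast; ring
  | one => rw [hx1]; push_cast; ring
  | more n ih₀ ih₁ => rw [hrec, ih₀, ih₁]; push_cast; ring

theorem stmt4 (c : ℤ) (hc : 2 ≤ |c|) (x : ℕ → ℤ)
    (hx0 : x 0 = 4 * c ^ 2 - 1) (hx1 : x 1 = 2 * c ^ 3)
    (hrec : ∀ n : ℕ, x (n + 2) = 2 * c * x (n + 1) + (-(c ^ 2)) * x n) :
    x 2 = c ^ 2 ∧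
    (∀ n : ℕ, 3 ≤ n → x n = c ^ n * (((n : ℤ) - 1) - (2 * (n : ℤ) - 4) * c ^ 2)) ∧
    (∀ n : ℕ, x n ≠ 0) := by
  have closed := eq_pow_mul_of_recurrence c x hx0 hx1 hrec
  refine ⟨by rw [closed]; push_cast; ring, fun n _ => closed n, fun n => ?_⟩
  have hc0 : c ≠ 0 := by
    rintro rfl
    simp at hc
  have hsq : 4 ≤ c ^ 2 := by
    rw [← sq_abs]
    nlinarith
  rw [closed]
  refine mul_ne_zero (pow_ne_zero n hc0) fun h => ?_
  rcases lt_or_ge n 3 with hn | hn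
  · interval_cases n <;> push_cast at h <;> linarith
  · have hn' : (3 : ℤ) ≤ n := by exact_mod_cast hn
    nlinarith
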